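/- Property 6: let n ≥ 1 and p1, p2 : Fin n → ℕ, let A = {j : p1(j) ≤ p2(j)} and B = {j : p1(j) > p2(j)} with A nonempty, and let pmaxA1 = max_{j ∈ A} p1(j) and pmaxB2 = max_{j ∈ B} p2(j). Assume ∑_j p2(j) ≤ ∑_j p1(j) − pmaxA1. Index the B-jobs in nonincreasing order of p2 and suppose kB satisfies: the sum of p2 over the jobs of B with the smallest p2 values (those sequenced last) is at most the sum of p1 over those same jobs minus pmaxB2. Then every permutation σ that first schedules the jobs of A in an arbitrary order, then the remaining jobs of B in an arbitrary order, and finally those last jobs of B in nonincreasing order of p2, attains the minimum makespan: Cmax(σ) ≤ Cmax(π) for every permutation π. -/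

import Mathlib

/-- Makespan of a permutation schedule in the two-machine flow shop. -/
def Cmax (n : ℕ) (p1 p2 : Fin n → ℕ) (σ : Equiv.Perm (Fin n)) : ℕ :=
  Finset.univ.sup
    (fun k : Fin n => (∑ i ∈ Finset.Iic k, p1 (σ i)) + ∑ i ∈ Finset.Ici k, p2 (σ i))

/-- Length of the path in the schedule `τ` that changes machine at position `k`. -/
def pathLength {n : ℕ} (p1 p2 : Fin n → ℕ) (τ : Equiv.Perm (Fin n)) (k : Fin n) : ℕ :=
  ∑ i, ((if i ≤ k then p1 (τ i) else 0) + (if k ≤ i then p2 (τ i) else 0))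

theorem pathLength_eq {n : ℕ} (p1 p2 : Fin n → ℕ) (τ : Equiv.Perm (Fin n)) (k : Fin n) :
    (∑ i ∈ Finset.Iic k, p1 (τ i)) + ∑ i ∈ Finset.Ici k, p2 (τ i) = pathLength p1 p2 τ k := by
  have h1 : Finset.Iic k = Finset.univ.filter (fun i => i ≤ k) := by ext; simp
  have h2 : Finset.Ici k = Finset.univ.filter (fun i => k ≤ i) := by ext; simp
  rw [pathLength, Finset.sum_add_distrib, h1, h2, Finset.sum_filter, Finset.sum_filter]

theorem pathLength_le_Cmax {n : ℕ} (p1 p2 : Fin n → ℕ) (τ : Equiv.Perm (Fin n)) (k : Fin n) :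
    pathLength p1 p2 τ k ≤ Cmax n p1 p2 τ := by
  rw [← pathLength_eq]
  exact Finset.le_sup
    (f := fun k : Fin n => (∑ i ∈ Finset.Iic k, p1 (τ i)) + ∑ i ∈ Finset.Ici k, p2 (τ i))
    (Finset.mem_univ k)

theorem Cmax_le_iff {n : ℕ} (p1 p2 : Fin n → ℕ) (τ : Equiv.Perm (Fin n)) (c : ℕ) :
    Cmax n p1 p2 τ ≤ c ↔ ∀ k, pathLength p1 p2 τ k ≤ c := by
  simp [Cmax, pathLength_eq]

theorem sum_le_Cmax {n : ℕ} (hn : 0 < n) (p1 p2 : Fin n → ℕ) (τ : Equiv.Perm (Fin n)) :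
    ∑ j, p1 j ≤ Cmax n p1 p2 τ := by
  refine le_trans ?_ (pathLength_le_Cmax p1 p2 τ ⟨n - 1, by omega⟩)
  rw [← Equiv.sum_comp τ p1, pathLength]
  refine Finset.sum_le_sum fun i _ => ?_
  rw [if_pos (by rw [Fin.le_def]; simp only; omega)]
  omega

/-- If no job sequenced before position `k` has `p1 > p2`, the path through `k` is bounded by
the total work on the second machine plus the first operation at `k`. -/
theorem pathLength_le_sum_add {n : ℕ} (p1 p2 : Fin n → ℕ) (τ : Equiv.Perm (Fin n)) (k : Fin n)
    (h : ∀ i < k, p1 (τ i) ≤ p2 (τ i)) :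
    pathLength p1 p2 τ k ≤ (∑ j, p2 j) + p1 (τ k) := by
  calc pathLength p1 p2 τ k
      ≤ ∑ i, (p2 (τ i) + if i = k then p1 (τ k) else 0) := by
        refine Finset.sum_le_sum fun i _ => ?_
        rcases lt_trichotomy i k with hik | rfl | hik
        · simpa [hik.le, hik.not_ge, hik.ne] using h i hik
        · simp [add_comm]
        · simp [hik.le, hik.not_ge]
    _ = (∑ j, p2 j) + p1 (τ k) := by
        rw [Finset.sum_add_distrib, Equiv.sum_comp τ p2]
        simp

/-- Johnson's lower bound: if every job after `k` has `p2 ≤ p1`, and the jobs before `k` either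
have `p1 ≤ p2` or have a second operation at least as long as that of `k`, then no schedule beats
the path of the identity schedule through `k`. -/
theorem pathLength_refl_le_Cmax {n : ℕ} (p1 p2 : Fin n → ℕ) (k : Fin n)
    (hafter : ∀ j, k < j → p2 j ≤ p1 j)
    (hbefore : ∀ j, j < k → p1 j ≤ p2 j ∨ p2 k ≤ p2 j) (π : Equiv.Perm (Fin n)) :
    pathLength p1 p2 (Equiv.refl _) k ≤ Cmax n p1 p2 π := by
  let S : Finset (Fin n) := Finset.univ.filter fun i => π i ≤ k ∧ p2 k ≤ p2 (π i)
  have hS : S.Nonempty := ⟨π.symm k, by simp [S]⟩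
  obtain ⟨hmk, hm2⟩ : π (S.max' hS) ≤ k ∧ p2 k ≤ p2 (π (S.max' hS)) := by
    simpa [S] using S.max'_mem hS
  have hmax : ∀ i, π i ≤ k → p2 k ≤ p2 (π i) → i ≤ S.max' hS := fun i h1 h2 =>
    S.le_max' i (by simp [S, h1, h2])
  generalize S.max' hS = m at hmk hm2 hmax
  let g : Fin n → ℕ := fun j => if j ≤ k then p1 j else p2 j
  calc pathLength p1 p2 (Equiv.refl _) k
      = ∑ j, (g j + if j = k then p2 k else 0) := by
        refine Finset.sum_congr rfl fun j _ => ?_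
        rcases lt_trichotomy j k with hjk | rfl | hjk
        · simp [g, hjk.le, hjk.not_ge, hjk.ne]
        · simp [g]
        · simp [g, hjk.le, hjk.not_ge, hjk.ne']
    _ = (∑ j, g j) + p2 k := by simp [Finset.sum_add_distrib]
    _ ≤ (∑ j, g j) + p2 (π m) := by omega
    _ = ∑ i, (g (π i) + if i = m then p2 (π m) else 0) := by
        rw [Finset.sum_add_distrib, Equiv.sum_comp π g]
        simp
    _ ≤ pathLength p1 p2 π m := by
        refine Finset.sum_le_sum fun i _ => ?_
        rcases lt_trichotomy i m with him | rfl | him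
        · by_cases hk : π i ≤ k
          · simp [g, him.le, him.ne, hk]
          · simpa [g, him.le, him.not_ge, him.ne, hk] using hafter _ (not_le.mp hk)
        · simp [g, hmk]
        · by_cases hk : π i ≤ k
          · have hlt : ¬ p2 k ≤ p2 (π i) := fun h => him.not_ge (hmax i hk h)
            have hne : π i ≠ k := fun h => hlt (by rw [h])
            simpa [g, him.le, him.not_ge, him.ne', hk] using
              (hbefore _ (lt_of_le_of_ne hk hne)).resolve_right hlt
          · simp [g, him.le, him.not_ge, him.ne', hk]
    _ ≤ Cmax n p1 p2 π := pathLength_le_Cmax p1 p2 π m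

/-- Property 6: jobs are indexed so that Johnson's set `A = {j : p1 j ≤ p2 j}`
occupies the first `nA` indices and set `B` the remaining ones, sorted in
nonincreasing order of `p2`; `A` is nonempty and `∑_j p2 j ≤ ∑_j p1 j − pmaxA1`.
If the last jobs of `B` (positions `≥ kB`, those with the smallest `p2` values)
satisfy `∑ p2 ≤ ∑ p1 − pmaxB2`, then every permutation scheduling first the jobs
of `A` in an arbitrary order, then the remaining jobs of `B` in an arbitrary
order, and finally those last jobs of `B` in nonincreasing order of `p2`,
attains the minimum makespan. -/
theorem flowshop_property6
    (n : ℕ) (hn : 0 < n) (p1 p2 : Fin n → ℕ)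
    (nA : ℕ)
    (hidx : ∀ i : Fin n, i.val < nA ↔ p1 i ≤ p2 i)
    (hantiB : ∀ i j : Fin n, i ≤ j → nA ≤ i.val → p2 j ≤ p2 i)
    (hAne : ∃ j : Fin n, p1 j ≤ p2 j)
    (hsum : (∑ j, p2 j) + (Finset.univ.filter (fun j : Fin n => p1 j ≤ p2 j)).sup p1
      ≤ ∑ j, p1 j)
    (kB : ℕ) (hkB1 : nA ≤ kB) (hkB2 : kB ≤ n)
    (hkBsum : (∑ i ∈ Finset.univ.filter (fun i : Fin n => kB ≤ i.val), p2 i)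
        + (Finset.univ.filter (fun j : Fin n => p2 j < p1 j)).sup p2
      ≤ ∑ i ∈ Finset.univ.filter (fun i : Fin n => kB ≤ i.val), p1 i)
    (σ : Equiv.Perm (Fin n))
    (hσ1 : ∀ i : Fin n, (σ i).val < nA ↔ i.val < nA)
    (hσ2 : ∀ i : Fin n, nA ≤ i.val → i.val < kB → nA ≤ (σ i).val ∧ (σ i).val < kB)
    (hσ3 : ∀ i : Fin n, kB ≤ i.val → σ i = i) :
    ∀ π : Equiv.Perm (Fin n), Cmax n p1 p2 σ ≤ Cmax n p1 p2 π := by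
  intro π
  rw [Cmax_le_iff]
  intro k
  have hσlt : ∀ i : Fin n, i.val < kB → (σ i).val < kB := fun i hi => by
    by_cases h : i.val < nA
    · exact ((hσ1 i).2 h).trans_le hkB1
    · exact (hσ2 i (not_lt.mp h) hi).2
  by_cases hkA : k.val < nA
  · have hA : ∀ i ≤ k, p1 (σ i) ≤ p2 (σ i) := fun i hi =>
      (hidx _).1 ((hσ1 i).2 (lt_of_le_of_lt hi hkA))
    have hmax : p1 (σ k) ≤ (Finset.univ.filter (fun j : Fin n => p1 j ≤ p2 j)).sup p1 :=
      Finset.le_sup (by simpa using hA k le_rfl)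
    have hle := pathLength_le_sum_add p1 p2 σ k fun i hi => hA i hi.le
    have hC := sum_le_Cmax hn p1 p2 π
    omega
  have hB : ∀ j : Fin n, nA ≤ j.val → p2 j < p1 j := fun j hj =>
    not_le.mp fun h => hj.not_gt ((hidx j).2 h)
  have hσB : ∀ i : Fin n, nA ≤ i.val → p2 (σ i) < p1 (σ i) := fun i hi =>
    hB _ (not_lt.mp fun h => hi.not_gt ((hσ1 i).1 h))
  by_cases hkk : k.val < kB
  · have hmax : p2 (σ k) ≤ (Finset.univ.filter (fun j : Fin n => p2 j < p1 j)).sup p2 :=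
      Finset.le_sup (by simpa using hσB k (not_lt.mp hkA))
    have hle : pathLength p1 p2 σ k ≤
        ∑ i, ((if kB ≤ i.val then p2 i else p1 (σ i)) + if i = k then p2 (σ k) else 0) := by
      refine Finset.sum_le_sum fun i _ => ?_
      rcases lt_trichotomy i k with hik | rfl | hik
      · have : ¬ kB ≤ i.val := by omega
        simp [hik.le, hik.not_ge, hik.ne, this]
      · simp [hkk.not_ge]
      · by_cases hi : kB ≤ i.val
        · simp [hik.le, hik.not_ge, hik.ne', hi, hσ3 i hi]
        · simpa [hik.le, hik.not_ge, hik.ne', hi] using (hσB i (by omega)).le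
    rw [Finset.sum_add_distrib, Finset.sum_ite] at hle
    simp only [Finset.sum_ite_eq', Finset.mem_univ, if_true] at hle
    have hsplit := Finset.sum_filter_add_sum_filter_not Finset.univ
      (fun i : Fin n => kB ≤ i.val) (fun i => p1 (σ i))
    have htail : ∑ i ∈ Finset.univ.filter (fun i : Fin n => kB ≤ i.val), p1 (σ i) =
        ∑ i ∈ Finset.univ.filter (fun i : Fin n => kB ≤ i.val), p1 i :=
      Finset.sum_congr rfl fun i hi => by rw [hσ3 i (by simpa using hi)]
    rw [Equiv.sum_comp σ p1] at hsplit
    have hC := sum_le_Cmax hn p1 p2 π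
    omega
  · have hiff : ∀ i, (i ≤ k ↔ σ i ≤ k) ∧ (k ≤ i ↔ k ≤ σ i) := fun i => by
      by_cases hi : kB ≤ i.val
      · simp [hσ3 i hi]
      · have := hσlt i (by omega)
        simp only [Fin.le_def]
        omega
    have hσk : pathLength p1 p2 σ k = pathLength p1 p2 (Equiv.refl _) k := by
      refine Eq.trans (Finset.sum_congr rfl fun i _ => ?_) (Equiv.sum_comp σ fun j =>
        (if j ≤ k then p1 j else 0) + if k ≤ j then p2 j else 0)
      rw [if_congr (hiff i).1 rfl rfl, if_congr (hiff i).2 rfl rfl]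
    rw [hσk]
    refine pathLength_refl_le_Cmax p1 p2 k (fun j hj => (hB j (by omega)).le) (fun j hj => ?_) π
    by_cases hj' : j.val < nA
    · exact Or.inl ((hidx j).1 hj')
    · exact Or.inr (hantiB j k hj.le (not_lt.mp hj'))
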